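/- Let p > 2 be real and λ > 0. Suppose u : ℝ → ℝ is twice continuously differentiable, u(x) > 0 for all x ∈ ℝ, u''(x) + u(x)^(p−1) = λ·u(x) for all x ∈ ℝ, u(x) → 0 and u'(x) → 0 as x → ±∞, and u(0) = sup_{x ∈ ℝ} u(x). Then u(x) = φ_{λ,p}(x) for every x ∈ ℝ. -/

import Mathlib

open Real Set MeasureTheory Filter

/-- A function on `ℝ` with zero derivative that tends to `l` at `+∞` is constantly `l`. -/
theorem eq_of_hasDerivAt_zero_of_tendsto {f : ℝ → ℝ} {l : ℝ} (hf : ∀ x, HasDerivAt f 0 x)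
    (hl : Tendsto f atTop (nhds l)) (x : ℝ) : f x = l := by
  have hc : f = fun _ => f x := funext fun y =>
    is_const_of_deriv_eq_zero (fun z => (hf z).differentiableAt) (fun z => (hf z).deriv) y x
  rw [hc] at hl
  exact tendsto_nhds_unique tendsto_const_nhds hl

/-- The solution of `w'' = k² w` with `w'(0) = 0` is `w(0) cosh (k x)`. -/
theorem eq_mul_cosh_of_hasDerivAt {w w' : ℝ → ℝ} {k : ℝ} (hk : k ≠ 0)
    (hw : ∀ x, HasDerivAt w (w' x) x) (hw' : ∀ x, HasDerivAt w' (k ^ 2 * w x) x)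
    (h0 : w' 0 = 0) (x : ℝ) : w x = w 0 * Real.cosh (k * x) := by
  have key : ∀ c : ℝ, c ^ 2 = k ^ 2 → w' x + c * w x = c * w 0 * Real.exp (c * x) := by
    intro c hc
    have hd : ∀ y, HasDerivAt (fun y => (w' y + c * w y) * Real.exp (-(c * y))) 0 y := by
      intro y
      have he : HasDerivAt (fun y : ℝ => Real.exp (-(c * y)))
          (Real.exp (-(c * y)) * -(c * 1)) y :=
        (((hasDerivAt_id y).const_mul c).neg).exp
      convert! ((hw' y).add ((hw y).const_mul c)).mul he using 1
      simp only [Pi.add_apply]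
      linear_combination w y * Real.exp (-(c * y)) * hc
    have h := is_const_of_deriv_eq_zero (fun z => (hd z).differentiableAt)
      (fun z => (hd z).deriv) x 0
    simp only [h0, mul_zero, neg_zero, Real.exp_zero, mul_one, zero_add] at h
    rw [← h, mul_assoc, ← Real.exp_add, neg_add_cancel, Real.exp_zero, mul_one]
  have h1 := key k rfl
  have h2 := key (-k) (by ring)
  rw [Real.cosh_eq]
  rw [neg_mul k x] at h2
  apply mul_left_cancel₀ hk
  linear_combination (h1 - h2) / 2

/-- Decaying solutions of `u'' + u^(p-1) = λ u` have zero energy. -/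
theorem energy_eq_zero {p lam : ℝ} (hp : 0 < p) {u u' : ℝ → ℝ}
    (hpos : ∀ x, 0 < u x) (hu : ∀ x, HasDerivAt u (u' x) x)
    (hu' : ∀ x, HasDerivAt u' (lam * u x - u x ^ (p - 1)) x)
    (htop : Tendsto u atTop (nhds 0)) (htop' : Tendsto u' atTop (nhds 0)) (x : ℝ) :
    u' x ^ 2 - lam * u x ^ 2 + 2 / p * u x ^ p = 0 := by
  refine eq_of_hasDerivAt_zero_of_tendsto
    (f := fun x => u' x ^ 2 - lam * u x ^ 2 + 2 / p * u x ^ p) (fun y => ?_) ?_ x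
  · convert! (((hu' y).pow 2).sub (((hu y).pow 2).const_mul lam)).add
      (((hu y).rpow_const (p := p) (Or.inl (hpos y).ne')).const_mul (2 / p)) using 1
    field_simp
    push_cast
    ring
  · have hr : Tendsto (fun x => u x ^ p) atTop (nhds 0) := by
      simpa [Real.zero_rpow hp.ne'] using htop.rpow_const (p := p) (Or.inr hp.le)
    simpa using ((htop'.pow 2).sub ((htop.pow 2).const_mul lam)).add (hr.const_mul (2 / p))

/-- The substitution `w = u^(-(p-2)/2)` turns a zero-energy solution of `u'' + u^(p-1) = λ u`
into a solution of a linear equation. -/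
theorem hasDerivAt_deriv_rpow_neg {p lam : ℝ} (hp : 0 < p) {u u' : ℝ → ℝ}
    (hpos : ∀ x, 0 < u x) (hu : ∀ x, HasDerivAt u (u' x) x)
    (hu' : ∀ x, HasDerivAt u' (lam * u x - u x ^ (p - 1)) x)
    (henergy : ∀ x, u' x ^ 2 - lam * u x ^ 2 + 2 / p * u x ^ p = 0) (x : ℝ) :
    HasDerivAt (fun x => u' x * -((p - 2) / 2) * u x ^ (-((p - 2) / 2) - 1))
      (((p - 2) / 2) ^ 2 * lam * u x ^ (-((p - 2) / 2))) x := by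
  convert! ((hu' x).mul_const (-((p - 2) / 2))).mul
    ((hu x).rpow_const (p := -((p - 2) / 2) - 1) (Or.inl (hpos x).ne')) using 1
  have hx := hpos x
  set b := -((p - 2) / 2) - 1 - 1 with hb
  have e1 : u x ^ (-((p - 2) / 2) - 1) = u x ^ b * u x := by
    rw [← Real.rpow_add_one hx.ne']; congr 1; rw [hb]; ring
  have e2 : u x ^ (-((p - 2) / 2)) = u x ^ b * u x * u x := by
    rw [← Real.rpow_add_one hx.ne', ← Real.rpow_add_one hx.ne']; congr 1; rw [hb]; ring
  have e3 : u x ^ p = u x ^ (p - 1) * u x := by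
    rw [← Real.rpow_add_one hx.ne']; congr 1; ring
  have h := henergy x
  rw [e3] at h
  rw [e1, e2]
  have hc : 2 / p * p = 2 := by field_simp
  linear_combination (-(p - 2) * p / 4 * u x ^ b) * h
    + ((p - 2) / 4 * u x ^ b * u x ^ (p - 1) * u x) * hc

/-- Uniqueness of the positive decaying solution of `u'' + u^(p-1) = λ u` on `ℝ`
normalized so that its maximum is attained at `0`: it coincides with the soliton
`φ_{λ,p}`. -/
theorem stmt_4 (p lam : ℝ) (hp : 2 < p) (hlam : 0 < lam)
    (φ : ℝ → ℝ)
    (hφ : ∀ x, φ x = (p * lam / 2) ^ (1 / (p - 2)) *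
      Real.cosh ((p - 2) / 2 * Real.sqrt lam * x) ^ (-(2 / (p - 2))))
    (u : ℝ → ℝ) (hu : ContDiff ℝ 2 u)
    (hpos : ∀ x, 0 < u x)
    (heq : ∀ x, deriv (deriv u) x + u x ^ (p - 1) = lam * u x)
    (htop : Tendsto u atTop (nhds 0))
    (hbot : Tendsto u atBot (nhds 0))
    (htop' : Tendsto (deriv u) atTop (nhds 0))
    (hbot' : Tendsto (deriv u) atBot (nhds 0))
    (hmax : ∀ x, u x ≤ u 0) :
    ∀ x, u x = φ x := by
  have hu1 : ∀ x, HasDerivAt u (deriv u x) x := fun x =>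
    (hu.differentiable (by norm_num) x).hasDerivAt
  have hu2 : ∀ x, HasDerivAt (deriv u) (lam * u x - u x ^ (p - 1)) x := by
    intro x
    have hd : ContDiff ℝ 1 (deriv u) :=
      ((contDiff_succ_iff_deriv (n := 1)).1 (by simpa [one_add_one_eq_two] using hu)).2.2
    rw [← heq x, add_sub_cancel_right]
    exact (hd.differentiable (by norm_num) x).hasDerivAt
  have hp0 : 0 < p := by linarith
  have hp2 : 0 < p - 2 := by linarith
  have henergy := energy_eq_zero hp0 hpos hu1 hu2 htop htop'
  have hcrit : deriv u 0 = 0 :=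
    IsLocalMax.deriv_eq_zero (Eventually.of_forall hmax)
  have h0 := hpos 0
  have hval : u 0 ^ (p - 2) = p * lam / 2 := by
    have h := henergy 0
    have e : u 0 ^ p = u 0 ^ (p - 2) * u 0 ^ 2 := by
      rw [← Real.rpow_natCast, ← Real.rpow_add h0]; congr 1; push_cast; ring
    rw [hcrit, e] at h
    field_simp at h
    have hsq : u 0 ^ 2 ≠ 0 := by positivity
    apply mul_right_cancel₀ hsq
    linear_combination h / 2
  have hu0 : u 0 = (p * lam / 2) ^ (1 / (p - 2)) := by
    rw [← hval, one_div, Real.rpow_rpow_inv h0.le hp2.ne']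
  have hk : (p - 2) / 2 * Real.sqrt lam ≠ 0 := by positivity
  intro x
  have hw := eq_mul_cosh_of_hasDerivAt (w := fun x => u x ^ (-((p - 2) / 2))) hk
    (fun x => (hu1 x).rpow_const (Or.inl (hpos x).ne'))
    (fun x => by
      rw [mul_pow, Real.sq_sqrt hlam.le]
      exact hasDerivAt_deriv_rpow_neg hp0 hpos hu1 hu2 henergy x)
    (by simp [hcrit]) x
  have hinv : ∀ y, (u y ^ (-((p - 2) / 2))) ^ (-(2 / (p - 2))) = u y := by
    intro y
    rw [← Real.rpow_mul (hpos y).le]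
    convert! Real.rpow_one (u y) using 2
    field_simp
  have h : (u x ^ (-((p - 2) / 2))) ^ (-(2 / (p - 2))) = _ :=
    congrArg (fun t : ℝ => t ^ (-(2 / (p - 2)))) hw
  rw [Real.mul_rpow (Real.rpow_nonneg h0.le _) (Real.cosh_pos _).le, hinv, hinv] at h
  rw [hφ, h, hu0]
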